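/- For any non-trivial bicolouring of the convex m-gon P_m (m ≥ 4) and any blue vertex v, every permissible triangulation of P_m is joined in the flip graph of permissible triangulations to the fan triangulation at v (the set of all m−3 diagonals having v as an endpoint). -/

import Mathlib

/-!
Vertices of the convex `m`-gon `P_m` are identified with `ZMod m` in cyclic order.
Blue is encoded by the Boolean value `true`, red by `false`.
-/

namespace Poly

/-- A diagonal of `P_m`: an unordered pair `{i, j}` of vertices with
`j - i ≢ 0, 1, -1 (mod m)`. -/
def IsDiag (m : ℕ) (e : Sym2 (ZMod m)) : Prop :=
  ∃ i j : ZMod m, e = s(i, j) ∧ j - i ≠ 0 ∧ j - i ≠ 1 ∧ j - i ≠ -1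

/-- `x` lies in the open cyclic interval from `a` to `b` (going in the positive
cyclic direction). -/
def StrictBtw (m : ℕ) (a x b : ZMod m) : Prop :=
  0 < (x - a).val ∧ (x - a).val < (b - a).val

/-- Two diagonals `{a,b}` and `{c,d}` cross: their four endpoints are distinct and
exactly one of `c`, `d` lies in the open cyclic interval from `a` to `b`. -/
def Cross (m : ℕ) (e f : Sym2 (ZMod m)) : Prop :=
  ∃ a b c d : ZMod m, e = s(a, b) ∧ f = s(c, d) ∧
    a ≠ b ∧ a ≠ c ∧ a ≠ d ∧ b ≠ c ∧ b ≠ d ∧ c ≠ d ∧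
    Xor' (StrictBtw m a c b) (StrictBtw m a d b)

/-- A triangulation of `P_m`: a set of `m - 3` pairwise non-crossing diagonals. -/
def IsTriangulation (m : ℕ) (T : Finset (Sym2 (ZMod m))) : Prop :=
  T.card = m - 3 ∧ (∀ e ∈ T, IsDiag m e) ∧
    ∀ e ∈ T, ∀ f ∈ T, e ≠ f → ¬ Cross m e f

/-- A bicolouring: a function from the vertices to {red, blue} attaining both values
(`true` = blue, `false` = red). -/
def IsBicolouring (m : ℕ) (c : ZMod m → Bool) : Prop :=
  (∃ v, c v = true) ∧ (∃ v, c v = false)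

/-- A bicolouring is non-trivial if some diagonal has both endpoints red. -/
def IsNontrivialBicolouring (m : ℕ) (c : ZMod m → Bool) : Prop :=
  IsBicolouring m c ∧ ∃ i j : ZMod m, IsDiag m s(i, j) ∧ c i = false ∧ c j = false

/-- A diagonal is permitted if at least one of its endpoints is blue. -/
def Permitted (m : ℕ) (c : ZMod m → Bool) (e : Sym2 (ZMod m)) : Prop :=
  ∃ v ∈ e, c v = true

/-- A permissible triangulation: a triangulation all of whose diagonals are permitted. -/
def IsPermissible (m : ℕ) (c : ZMod m → Bool) (T : Finset (Sym2 (ZMod m))) : Prop :=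
  IsTriangulation m T ∧ ∀ e ∈ T, Permitted m c e

/-- Two permissible triangulations are joined in the flip graph of permissible
triangulations: there is a finite sequence of permissible triangulations from one to the
other in which consecutive triangulations share exactly `m - 4` diagonals. -/
def PermFlipJoined (m : ℕ) (c : ZMod m → Bool) (T₁ T₂ : Finset (Sym2 (ZMod m))) : Prop :=
  ∃ n : ℕ, ∃ f : Fin (n + 1) → Finset (Sym2 (ZMod m)),
    f 0 = T₁ ∧ f (Fin.last n) = T₂ ∧ (∀ i, IsPermissible m c (f i)) ∧
    ∀ i : Fin n, (f i.castSucc ∩ f i.succ).card = m - 4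

/-- The position of `x` counted from `v` in the positive cyclic direction. -/
def pos {m : ℕ} (v x : ZMod m) : ℕ := (x - v).val

section Position

variable {m : ℕ} (v : ZMod m)

theorem pos_self : pos v v = 0 := by simp [pos]

theorem exists_pos_eq {k : ℕ} (hk : k < m) : ∃ x, pos v x = k :=
  ⟨k + v, by simp [pos, ZMod.val_natCast, Nat.mod_eq_of_lt hk]⟩

variable [NeZero m]

theorem pos_lt (x : ZMod m) : pos v x < m := ZMod.val_lt _

theorem pos_injective : Function.Injective (pos v) := fun x y h => by
  simpa using ZMod.val_injective m h

theorem pos_eq_zero_iff {x : ZMod m} : pos v x = 0 ↔ x = v := by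
  rw [← pos_self v, (pos_injective v).eq_iff]

theorem val_sub_eq (a x : ZMod m) :
    pos v a ≤ pos v x ∧ (x - a).val + pos v a = pos v x ∨
      pos v x < pos v a ∧ (x - a).val + pos v a = pos v x + m := by
  have key : pos v x = ((x - a).val + pos v a) % m := by
    rw [pos, pos, ← ZMod.val_add, sub_add_sub_cancel]
  have h₁ := ZMod.val_lt (x - a)
  have h₂ := pos_lt v a
  rcases lt_or_ge ((x - a).val + pos v a) m with h | h
  · rw [Nat.mod_eq_of_lt h] at key
    omega
  · rw [Nat.mod_eq_sub_mod h, Nat.mod_eq_of_lt (by omega)] at key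
    omega

theorem strictBtw_iff (a x b : ZMod m) :
    StrictBtw m a x b ↔ pos v a < pos v x ∧ pos v x < pos v b ∨
      pos v b < pos v a ∧ (pos v a < pos v x ∨ pos v x < pos v b) := by
  have h₁ := val_sub_eq v a x
  have h₂ := val_sub_eq v a b
  have h₃ := pos_lt v a
  have h₄ := pos_lt v b
  have h₅ := pos_lt v x
  unfold StrictBtw
  omega

theorem cross_mk_iff {a b c d : ZMod m} (hab : pos v a < pos v b) (hcd : pos v c < pos v d) :
    Cross m s(a, b) s(c, d) ↔
      pos v a < pos v c ∧ pos v c < pos v b ∧ pos v b < pos v d ∨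
        pos v c < pos v a ∧ pos v a < pos v d ∧ pos v d < pos v b := by
  constructor
  · rintro ⟨a', b', c', d', he, hf, -, hac, had, hbc, hbd, -, hx⟩
    replace hx := xor_def.1 hx
    rw [strictBtw_iff v, strictBtw_iff v] at hx
    rw [← (pos_injective v).ne_iff] at hac had hbc hbd
    rcases Sym2.eq_iff.1 he with ⟨rfl, rfl⟩ | ⟨rfl, rfl⟩ <;>
      rcases Sym2.eq_iff.1 hf with ⟨rfl, rfl⟩ | ⟨rfl, rfl⟩ <;> omega
  · intro h
    refine ⟨a, b, c, d, rfl, rfl, ?_, ?_, ?_, ?_, ?_, ?_, xor_def.2 ?_⟩ <;>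
      simp only [strictBtw_iff v, ← (pos_injective v).ne_iff] <;> omega

theorem isDiag_mk_iff (hm : 4 ≤ m) {a b : ZMod m} (hab : pos v a < pos v b) :
    IsDiag m s(a, b) ↔ pos v a + 2 ≤ pos v b ∧ pos v b + 2 ≤ pos v a + m := by
  have : Fact (1 < m) := ⟨by omega⟩
  have h_neg : (-1 : ZMod m).val = m - 1 := by
    rw [ZMod.neg_val, if_neg one_ne_zero, ZMod.val_one]
  have key (x y : ZMod m) : (y - x ≠ 0 ∧ y - x ≠ 1 ∧ y - x ≠ -1) ↔
      (y - x).val ≠ 0 ∧ (y - x).val ≠ 1 ∧ (y - x).val ≠ m - 1 := by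
    rw [← h_neg, ← ZMod.val_one m, ← ZMod.val_zero (n := m)]
    simp only [(ZMod.val_injective m).ne_iff]
  have hb := pos_lt v b
  have h₁ := val_sub_eq v a b
  have h₂ := val_sub_eq v b a
  constructor
  · rintro ⟨i, j, he, hij⟩
    rw [key] at hij
    rcases Sym2.eq_iff.1 he with ⟨rfl, rfl⟩ | ⟨rfl, rfl⟩ <;> omega
  · intro h
    refine ⟨a, b, rfl, (key a b).2 ?_⟩
    omega

theorem IsDiag.exists_pos_lt {e : Sym2 (ZMod m)} (he : IsDiag m e) :
    ∃ a b, e = s(a, b) ∧ pos v a < pos v b := by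
  obtain ⟨a, b, rfl, h, -⟩ := he
  have hab : pos v a ≠ pos v b := (pos_injective v).ne (fun h' => h (by simp [h']))
  rcases hab.lt_or_gt with h | h
  · exact ⟨a, b, rfl, h⟩
  · exact ⟨b, a, Sym2.eq_swap, h⟩

end Position

theorem Cross.symm {m : ℕ} (hm : 4 ≤ m) {e f : Sym2 (ZMod m)} (he : IsDiag m e)
    (hf : IsDiag m f) (h : Cross m e f) : Cross m f e := by
  have : NeZero m := ⟨by omega⟩
  obtain ⟨a, b, rfl, hab⟩ := he.exists_pos_lt 0
  obtain ⟨c, d, rfl, hcd⟩ := hf.exists_pos_lt 0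
  rw [cross_mk_iff 0 hab hcd] at h
  rw [cross_mk_iff 0 hcd hab]
  exact h.symm

/-- If some diagonal of a non-crossing set `T` misses `v`, then some diagonal at `v` crosses
exactly one member of `T`. -/
theorem exists_cross_unique {m : ℕ} (hm : 4 ≤ m) (v : ZMod m) (T : Finset (Sym2 (ZMod m)))
    (hdiag : ∀ e ∈ T, IsDiag m e) (hcross : ∀ e ∈ T, ∀ f ∈ T, e ≠ f → ¬ Cross m e f)
    (hv : ∃ e ∈ T, v ∉ e) :
    ∃ e ∈ T, v ∉ e ∧ ∃ f, IsDiag m f ∧ v ∈ f ∧ Cross m e f ∧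
      ∀ g ∈ T, g ≠ e → ¬ Cross m g f := by
  have : NeZero m := ⟨by omega⟩
  let P := (Finset.univ : Finset (ZMod m × ZMod m)).filter
    (fun q => s(q.1, q.2) ∈ T ∧ 0 < pos v q.1 ∧ pos v q.1 < pos v q.2)
  have hP : P.Nonempty := by
    obtain ⟨e, he, hve⟩ := hv
    obtain ⟨a, b, rfl, hab⟩ := (hdiag e he).exists_pos_lt v
    refine ⟨(a, b), Finset.mem_filter.2 ⟨Finset.mem_univ _, he, ?_, hab⟩⟩
    rw [Nat.pos_iff_ne_zero, Ne, pos_eq_zero_iff]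
    rintro rfl
    exact hve (Sym2.mem_mk_left _ _)
  obtain ⟨⟨a, b⟩, hmem, hmax⟩ := P.exists_max_image (fun q => pos v q.2 - pos v q.1) hP
  simp only [P, Finset.mem_filter, Finset.mem_univ, true_and, Prod.forall] at hmem hmax
  obtain ⟨habT, ha, hab⟩ := hmem
  have hlen := (isDiag_mk_iff v hm hab).1 (hdiag _ habT)
  have hb := pos_lt v b
  let Q := (Finset.univ : Finset (ZMod m)).filter
    (fun w => pos v a < pos v w ∧ pos v w < pos v b ∧ (s(a, w) ∈ T ∨ pos v w = pos v a + 1))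
  have hQ : Q.Nonempty := by
    obtain ⟨w, hw⟩ := exists_pos_eq v (k := pos v a + 1) (by omega)
    exact ⟨w, Finset.mem_filter.2 ⟨Finset.mem_univ _, by omega, by omega, Or.inr hw⟩⟩
  obtain ⟨w, hmem, hwmax⟩ := Q.exists_max_image (pos v) hQ
  simp only [Q, Finset.mem_filter, Finset.mem_univ, true_and] at hmem hwmax
  obtain ⟨haw, hwb, hw⟩ := hmem
  have hv0 := pos_self v
  have hvw : pos v v < pos v w := by omega
  refine ⟨s(a, b), habT, ?_, s(v, w), ?_, Sym2.mem_mk_left _ _, ?_, ?_⟩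
  · rw [Sym2.mem_iff]
    rintro (rfl | rfl) <;> omega
  · rw [isDiag_mk_iff v hm hvw]
    omega
  · rw [cross_mk_iff v hab hvw]
    omega
  · intro g hg hne h
    obtain ⟨i, j, rfl, hij⟩ := (hdiag g hg).exists_pos_lt v
    rw [cross_mk_iff v hij hvw] at h
    have hi : 0 < pos v i := by omega
    have h₁ := hcross _ hg _ habT hne
    rw [cross_mk_iff v hij hab] at h₁
    have h₂ := hmax i j ⟨hg, hi, hij⟩
    have hai : pos v a ≤ pos v i := by omega
    have hjb : pos v j ≤ pos v b := by omega
    by_cases hia : i = a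
    · subst hia
      have hjb' : pos v j ≠ pos v b := fun h' => hne (by rw [pos_injective v h'])
      have h₃ := hwmax j ⟨hij, by omega, Or.inl hg⟩
      omega
    · have hia' := (pos_injective v).ne hia
      rcases hw with hw | hw
      · have h₃ := hcross _ hg _ hw (fun h' => by
          rcases Sym2.eq_iff.1 h' with ⟨h', -⟩ | ⟨rfl, rfl⟩
          · exact hia h'
          · omega)
        rw [cross_mk_iff v hij haw] at h₃
        omega
      · omega

theorem PermFlipJoined.refl {m : ℕ} {c : ZMod m → Bool} {T : Finset (Sym2 (ZMod m))}
    (hT : IsPermissible m c T) : PermFlipJoined m c T T :=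
  ⟨0, fun _ => T, rfl, rfl, fun _ => hT, fun i => i.elim0⟩

theorem PermFlipJoined.head {m : ℕ} {c : ZMod m → Bool} {T T' U : Finset (Sym2 (ZMod m))}
    (hT : IsPermissible m c T) (hcard : (T ∩ T').card = m - 4) (h : PermFlipJoined m c T' U) :
    PermFlipJoined m c T U := by
  obtain ⟨n, f, h0, hlast, hperm, hflip⟩ := h
  refine ⟨n + 1, Fin.cons T f, rfl, ?_, ?_, ?_⟩
  · rw [← Fin.succ_last, Fin.cons_succ, hlast]
  · exact Fin.cases hT hperm
  · refine Fin.cases ?_ fun i => ?_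
    · simpa [h0] using hcard
    · rw [← Fin.succ_castSucc, Fin.cons_succ, Fin.cons_succ]
      exact hflip i

/-- A permissible triangulation with a diagonal missing the blue vertex `v` can be flipped so as
to have fewer such diagonals. -/
theorem IsPermissible.exists_flip {m : ℕ} (hm : 4 ≤ m) {c : ZMod m → Bool} {v : ZMod m}
    (hv : c v = true) {T : Finset (Sym2 (ZMod m))} (hT : IsPermissible m c T)
    (h : ∃ e ∈ T, v ∉ e) :
    ∃ T', IsPermissible m c T' ∧ (T ∩ T').card = m - 4 ∧
      (T'.filter (v ∉ ·)).card < (T.filter (v ∉ ·)).card := by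
  obtain ⟨⟨hcard, hdiag, hcross⟩, hperm⟩ := hT
  obtain ⟨e, he, hve, f, hf, hvf, hef, huniq⟩ := exists_cross_unique hm v T hdiag hcross h
  have hfT : f ∉ T := fun hfT => hcross e he f hfT (by rintro rfl; exact hve hvf) hef
  refine ⟨insert f (T.erase e), ⟨⟨?_, ?_, ?_⟩, ?_⟩, ?_, ?_⟩
  · rw [Finset.card_insert_of_notMem (fun h => hfT (Finset.mem_of_mem_erase h)),
      Finset.card_erase_of_mem he]
    omega
  · intro g hg
    rcases Finset.mem_insert.1 hg with rfl | hg
    · exact hf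
    · exact hdiag g (Finset.mem_of_mem_erase hg)
  · intro g hg g' hg' hne hgg'
    simp only [Finset.mem_insert, Finset.mem_erase] at hg hg'
    rcases hg with rfl | ⟨hge, hg⟩ <;> rcases hg' with rfl | ⟨hge', hg'⟩
    · exact hne rfl
    · exact huniq g' hg' hge' (hgg'.symm hm hf (hdiag g' hg'))
    · exact huniq g hg hge hgg'
    · exact hcross g hg g' hg' hne hgg'
  · intro g hg
    rcases Finset.mem_insert.1 hg with rfl | hg
    · exact ⟨v, hvf, hv⟩
    · exact hperm g (Finset.mem_of_mem_erase hg)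
  · rw [Finset.inter_insert_of_notMem hfT, Finset.inter_eq_right.2 (Finset.erase_subset e T),
      Finset.card_erase_of_mem he]
    omega
  · refine Finset.card_lt_card (Finset.ssubset_iff_of_subset ?_ |>.2 ⟨e, ?_, ?_⟩)
    · intro g
      simp only [Finset.mem_filter, Finset.mem_insert, Finset.mem_erase]
      rintro ⟨rfl | hg, hvg⟩
      · exact absurd hvf hvg
      · exact ⟨hg.2, hvg⟩
    · simp [he, hve]
    · have : e ≠ f := by rintro rfl; exact hve hvf
      simp [this]

theorem card_fan_le {m : ℕ} (hm : 4 ≤ m) {v : ZMod m} {F : Finset (Sym2 (ZMod m))}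
    (hF : ∀ e ∈ F, IsDiag m e ∧ v ∈ e) : F.card ≤ m - 3 := by
  have : NeZero m := ⟨by omega⟩
  have hsub : F ⊆ (Finset.Icc 2 (m - 2)).image (fun k : ℕ => s(v, v + k)) := by
    intro e he
    obtain ⟨hd, hve⟩ := hF e he
    obtain ⟨x, rfl⟩ := Sym2.mem_iff_exists.1 hve
    have hvx : pos v v < pos v x := by
      rw [pos_self, Nat.pos_iff_ne_zero, Ne, pos_eq_zero_iff]
      rintro rfl
      obtain ⟨a, b, h, hab⟩ := hd.exists_pos_lt x
      rcases Sym2.eq_iff.1 h with ⟨rfl, rfl⟩ | ⟨rfl, rfl⟩ <;> omega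
    have h := (isDiag_mk_iff v hm hvx).1 hd
    rw [pos_self] at h
    refine Finset.mem_image.2 ⟨pos v x, Finset.mem_Icc.2 (by omega), ?_⟩
    simp [pos]
  calc F.card ≤ _ := Finset.card_le_card hsub
    _ ≤ (Finset.Icc 2 (m - 2)).card := Finset.card_image_le
    _ = m - 3 := by rw [Nat.card_Icc]; omega

/-- For any non-trivial bicolouring of `P_m` (`m ≥ 4`) and any blue
vertex `v`, every permissible triangulation is joined in the flip graph of permissible
triangulations to the fan triangulation at `v` (the set of all `m - 3` diagonals having
`v` as an endpoint). -/
theorem joined_to_fan (m : ℕ) (hm : 4 ≤ m) (c : ZMod m → Bool)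
    (hc : IsNontrivialBicolouring m c) (v : ZMod m) (hv : c v = true)
    (F : Finset (Sym2 (ZMod m))) (hF : ∀ e, e ∈ F ↔ IsDiag m e ∧ v ∈ e)
    (T : Finset (Sym2 (ZMod m))) (hT : IsPermissible m c T) :
    PermFlipJoined m c T F := by
  induction hn : (T.filter (v ∉ ·)).card using Nat.strong_induction_on generalizing T with
  | _ n ih =>
    by_cases h : ∃ e ∈ T, v ∉ e
    · obtain ⟨T', hT', hcard, hlt⟩ := hT.exists_flip hm hv h
      exact (ih _ (hn ▸ hlt) T' hT' rfl).head hT hcard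
    · push Not at h
      have hTF : T = F := Finset.eq_of_subset_of_card_le
        (fun e he => (hF e).2 ⟨hT.1.2.1 e he, h e he⟩)
        (hT.1.1 ▸ card_fan_le hm fun e he => (hF e).1 he)
      exact hTF ▸ PermFlipJoined.refl hT

end Poly
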